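/- Let H be a real inner product space, let c ∈ (0,1), and let δ, C̄ be real numbers with 0 < δ ≤ C̄. Let ξ, η ∈ H satisfy ‖ξ‖ ≤ C̄, ‖η‖ ≤ C̄, ‖ξ‖ > δ, and ⟨η, ξ⟩ ≤ c‖ξ‖². Then there exists t ∈ (0,1) such that ‖t η + (1 - t) ξ‖² ≤ (1 - (1-c)² δ² / (4 C̄²)) ‖ξ‖², and the factor 1 - (1-c)² δ² / (4 C̄²) lies in (0,1). -/

import Mathlib

open scoped RealInnerProductSpace

theorem norm_sq_smul_add_one_sub_smul {H : Type*} [NormedAddCommGroup H] [InnerProductSpace ℝ H]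
    (t : ℝ) (x y : H) :
    ‖t • y + (1 - t) • x‖ ^ 2 = t ^ 2 * ‖y - x‖ ^ 2 + 2 * t * (⟪y, x⟫ - ‖x‖ ^ 2) + ‖x‖ ^ 2 := by
  rw [norm_add_sq_real, norm_sub_sq_real, norm_smul, norm_smul, real_inner_smul_left,
    real_inner_smul_right, mul_pow, mul_pow, Real.norm_eq_abs, Real.norm_eq_abs, sq_abs, sq_abs]
  ring

theorem stmt_10 {H : Type*} [NormedAddCommGroup H] [InnerProductSpace ℝ H]
    (c : ℝ) (hc : c ∈ Set.Ioo (0 : ℝ) 1)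
    (δ Cbar : ℝ) (hδ : 0 < δ) (hδC : δ ≤ Cbar)
    (ξ η : H) (hξ : ‖ξ‖ ≤ Cbar) (hη : ‖η‖ ≤ Cbar) (hξδ : δ < ‖ξ‖)
    (hinner : ⟪η, ξ⟫ ≤ c * ‖ξ‖ ^ 2) :
    (∃ t ∈ Set.Ioo (0 : ℝ) 1,
      ‖t • η + (1 - t) • ξ‖ ^ 2 ≤ (1 - (1 - c) ^ 2 * δ ^ 2 / (4 * Cbar ^ 2)) * ‖ξ‖ ^ 2) ∧
    (1 - (1 - c) ^ 2 * δ ^ 2 / (4 * Cbar ^ 2)) ∈ Set.Ioo (0 : ℝ) 1 := by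
  obtain ⟨hc0, hc1⟩ := hc
  have hC : 0 < Cbar := hδ.trans_le hδC
  have hd : 0 < 1 - c := sub_pos.2 hc1
  have hξ0 : 0 < ‖ξ‖ := hδ.trans hξδ
  have hξC : ‖ξ‖ ^ 2 ≤ Cbar ^ 2 := by gcongr
  have hδξ : δ ^ 2 ≤ ‖ξ‖ ^ 2 := by gcongr
  have hC2 : 0 < Cbar ^ 2 := by positivity
  refine ⟨⟨(1 - c) * ‖ξ‖ ^ 2 / (4 * Cbar ^ 2), ⟨by positivity, ?_⟩, ?_⟩, ?_, ?_⟩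
  · rw [div_lt_one (by positivity)]
    nlinarith [mul_pos hc0 (pow_pos hξ0 2)]
  · set t := (1 - c) * ‖ξ‖ ^ 2 / (4 * Cbar ^ 2) with ht
    have ht0 : 0 < t := by positivity
    have hdist : ‖η - ξ‖ ≤ 2 * Cbar := (norm_sub_le η ξ).trans (by linarith)
    calc ‖t • η + (1 - t) • ξ‖ ^ 2
        = t ^ 2 * ‖η - ξ‖ ^ 2 + 2 * t * (⟪η, ξ⟫ - ‖ξ‖ ^ 2) + ‖ξ‖ ^ 2 :=
          norm_sq_smul_add_one_sub_smul t ξ η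
      _ ≤ t ^ 2 * (2 * Cbar) ^ 2 + 2 * t * (c * ‖ξ‖ ^ 2 - ‖ξ‖ ^ 2) + ‖ξ‖ ^ 2 := by gcongr
      _ = (1 - (1 - c) ^ 2 * ‖ξ‖ ^ 2 / (4 * Cbar ^ 2)) * ‖ξ‖ ^ 2 := by
          rw [ht]
          field_simp
          ring
      _ ≤ (1 - (1 - c) ^ 2 * δ ^ 2 / (4 * Cbar ^ 2)) * ‖ξ‖ ^ 2 := by gcongr
  · rw [sub_pos, div_lt_one (by positivity)]
    have hd1 : (1 - c) ^ 2 ≤ 1 := pow_le_one₀ hd.le (by linarith)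
    nlinarith [mul_le_mul_of_nonneg_right hd1 (sq_nonneg δ)]
  · exact sub_lt_self _ (by positivity)
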